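/- The scaled variance satisfies the refined asymptotic lim_{n→∞} √n · ( v(n) − (2 − π/2) ) = −√(π/18); equivalently, v(n) = 2 − π/2 − √(π/(18 n)) + o(1/√n) as n → ∞. -/

import Mathlib

open Finset Real Filter

/-- Probability mass function of the Mlynar distribution with parameter `n`:
`p_{k,n} = k·(n-1)!/(n^k·(n-k)!)`. -/
noncomputable def mlynarP (n k : ℕ) : ℝ :=
  (k : ℝ) * (Nat.factorial (n - 1)) / ((n : ℝ) ^ k * (Nat.factorial (n - k)))

open MeasureTheory Topology

/-! ### Moments in terms of the tail probabilities -/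

/-- The tail probability `P(G_n ≥ k) = n (n - 1) ⋯ (n - k + 1) / n ^ k` of the Mlynar
distribution. -/
noncomputable def mlynarTail (n k : ℕ) : ℝ := (n.descFactorial k : ℝ) / (n : ℝ) ^ k

lemma mul_mlynarTail {n k : ℕ} (hn : n ≠ 0) (hk : k ≤ n) :
    (k : ℝ) * mlynarTail n k = n * mlynarP n k := by
  have hn' : (n : ℝ) ≠ 0 := by exact_mod_cast hn
  have h1 : (n.factorial : ℝ) = n * (n - 1).factorial := by
    exact_mod_cast (Nat.mul_factorial_pred hn).symm
  have h2 : ((n - k).factorial : ℝ) * n.descFactorial k = n.factorial := by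
    exact_mod_cast Nat.factorial_mul_descFactorial hk
  have h3 : ((n - k).factorial : ℝ) ≠ 0 := by positivity
  rw [mlynarTail, mlynarP]
  field_simp
  linear_combination (k : ℝ) * h2 + k * h1

lemma mlynarTail_sub_succ {n k : ℕ} (hn : n ≠ 0) (hk : k ≤ n) :
    mlynarTail n k - mlynarTail n (k + 1) = mlynarP n k := by
  have hn' : (n : ℝ) ≠ 0 := by exact_mod_cast hn
  have h := mul_mlynarTail hn hk
  have h2 : (n.descFactorial (k + 1) : ℝ) = (n - k) * n.descFactorial k := by
    rw [Nat.descFactorial_succ]; push_cast [Nat.cast_sub hk]; ring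
  have h3 : mlynarTail n (k + 1) = (n - k) / n * mlynarTail n k := by
    rw [mlynarTail, mlynarTail, h2, pow_succ]; field_simp
  rw [h3, ← mul_right_inj' hn', ← h]
  field_simp
  ring

lemma sum_Icc_mul_telescope (t a : ℕ → ℝ) (m : ℕ) :
    ∑ k ∈ Icc 1 m, a k * (t k - t (k + 1)) =
      ∑ k ∈ Icc 1 m, (a k - a (k - 1)) * t k + a 0 * t 1 - a m * t (m + 1) := by
  induction m with
  | zero => simp
  | succ m ih =>
    rw [Finset.sum_Icc_succ_top (by omega), Finset.sum_Icc_succ_top (by omega), ih]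
    simp only [Nat.add_sub_cancel]
    ring

lemma sum_mlynarP {n : ℕ} (hn : n ≠ 0) : ∑ k ∈ Icc 1 n, mlynarP n k = 1 := by
  have hn' : (n : ℝ) ≠ 0 := by exact_mod_cast hn
  have h : ∑ k ∈ Icc 1 n, mlynarP n k =
      ∑ k ∈ Icc 1 n, 1 * (mlynarTail n k - mlynarTail n (k + 1)) :=
    Finset.sum_congr rfl fun k hk => by
      rw [mlynarTail_sub_succ hn (Finset.mem_Icc.1 hk).2, one_mul]
  rw [h, sum_Icc_mul_telescope _ fun _ => 1]
  simp [mlynarTail, hn']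

lemma sum_mul_mlynarP {n : ℕ} (hn : n ≠ 0) (a : ℕ → ℝ) (ha : a 0 = 0) :
    ∑ k ∈ Icc 1 n, a k * mlynarP n k = ∑ k ∈ Icc 1 n, (a k - a (k - 1)) * mlynarTail n k := by
  have h : ∑ k ∈ Icc 1 n, a k * mlynarP n k =
      ∑ k ∈ Icc 1 n, a k * (mlynarTail n k - mlynarTail n (k + 1)) :=
    Finset.sum_congr rfl fun k hk => by rw [mlynarTail_sub_succ hn (Finset.mem_Icc.1 hk).2]
  rw [h, sum_Icc_mul_telescope, ha]
  simp [mlynarTail]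

lemma sum_id_mul_mlynarP {n : ℕ} (hn : n ≠ 0) :
    ∑ k ∈ Icc 1 n, (k : ℝ) * mlynarP n k = ∑ k ∈ Icc 1 n, mlynarTail n k := by
  rw [sum_mul_mlynarP hn (fun k => (k : ℝ)) (by simp)]
  refine Finset.sum_congr rfl fun k hk => ?_
  push_cast [Nat.cast_sub (Finset.mem_Icc.1 hk).1]
  ring

lemma sum_sq_mul_mlynarP {n : ℕ} (hn : n ≠ 0) :
    ∑ k ∈ Icc 1 n, (k : ℝ) ^ 2 * mlynarP n k = 2 * n - ∑ k ∈ Icc 1 n, mlynarTail n k := by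
  rw [sum_mul_mlynarP hn (fun k => (k : ℝ) ^ 2) (by simp), eq_sub_iff_add_eq,
    ← Finset.sum_add_distrib]
  calc ∑ k ∈ Icc 1 n, (((k : ℝ) ^ 2 - ((k - 1 : ℕ) : ℝ) ^ 2) * mlynarTail n k + mlynarTail n k)
      = ∑ k ∈ Icc 1 n, 2 * n * mlynarP n k := by
        refine Finset.sum_congr rfl fun k hk => ?_
        rw [mul_assoc, ← mul_mlynarTail hn (Finset.mem_Icc.1 hk).2]
        push_cast [Nat.cast_sub (Finset.mem_Icc.1 hk).1]
        ring
    _ = 2 * n := by rw [← Finset.mul_sum, sum_mlynarP hn, mul_one]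

/-! ### Bounds for the logarithm -/

lemma log_one_add_le_cubic {u : ℝ} (hu : 0 ≤ u) :
    log (1 + u) ≤ u - u ^ 2 / 2 + u ^ 3 / 3 := by
  have hd : ∀ x : ℝ, 0 ≤ x → HasDerivAt (fun x => x - x ^ 2 / 2 + x ^ 3 / 3 - log (1 + x))
      (x ^ 3 / (1 + x)) x := by
    intro x hx
    have h1 : (1 + x) ≠ 0 := by positivity
    refine ((((hasDerivAt_id' x).sub ((hasDerivAt_pow 2 x).div_const 2)).add
      ((hasDerivAt_pow 3 x).div_const 3)).sub
      (((hasDerivAt_id' x).const_add 1).log h1)).congr_deriv ?_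
    field_simp
    ring
  have hm : MonotoneOn (fun x => x - x ^ 2 / 2 + x ^ 3 / 3 - log (1 + x)) (Set.Ici 0) := by
    refine monotoneOn_of_deriv_nonneg (convex_Ici 0)
      (fun x hx => (hd x hx).continuousAt.continuousWithinAt) ?_ ?_
    all_goals
      intro x hx
      rw [interior_Ici] at hx
      have hx' : 0 ≤ x := le_of_lt hx
    · exact (hd x hx').differentiableAt.differentiableWithinAt
    · rw [(hd x hx').deriv]; positivity
  simpa using hm (Set.self_mem_Ici) hu hu

lemma quartic_le_log_one_add {u : ℝ} (hu : 0 ≤ u) :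
    u - u ^ 2 / 2 + u ^ 3 / 3 - u ^ 4 / 4 ≤ log (1 + u) := by
  have hd : ∀ x : ℝ, 0 ≤ x →
      HasDerivAt (fun x => log (1 + x) - (x - x ^ 2 / 2 + x ^ 3 / 3 - x ^ 4 / 4))
      (x ^ 4 / (1 + x)) x := by
    intro x hx
    have h1 : (1 + x) ≠ 0 := by positivity
    refine ((((hasDerivAt_id' x).const_add 1).log h1).sub
      ((((hasDerivAt_id' x).sub ((hasDerivAt_pow 2 x).div_const 2)).add
      ((hasDerivAt_pow 3 x).div_const 3)).sub
      ((hasDerivAt_pow 4 x).div_const 4))).congr_deriv ?_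
    field_simp
    ring
  have hm : MonotoneOn (fun x => log (1 + x) - (x - x ^ 2 / 2 + x ^ 3 / 3 - x ^ 4 / 4))
      (Set.Ici 0) := by
    refine monotoneOn_of_deriv_nonneg (convex_Ici 0)
      (fun x hx => (hd x hx).continuousAt.continuousWithinAt) ?_ ?_
    all_goals
      intro x hx
      rw [interior_Ici] at hx
      have hx' : 0 ≤ x := le_of_lt hx
    · exact (hd x hx').differentiableAt.differentiableWithinAt
    · rw [(hd x hx').deriv]; positivity
  simpa using hm (Set.self_mem_Ici) hu hu

lemma quadratic_le_log_one_add {u : ℝ} (hu : 0 ≤ u) : u - u ^ 2 / 2 ≤ log (1 + u) := by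
  refine le_trans ?_ (Real.le_log_one_add_of_nonneg hu)
  rw [le_div_iff₀ (by positivity)]
  nlinarith [pow_nonneg hu 3]

lemma log_one_add_le_sub_div {u : ℝ} (hu : 0 ≤ u) :
    log (1 + u) ≤ u - u ^ 2 / (2 * (1 + u)) := by
  have h1 : 0 < 1 + u := by positivity
  have h := Real.self_le_sinh_iff.2 (Real.log_nonneg (by linarith : 1 ≤ 1 + u))
  rw [Real.sinh_eq, Real.exp_neg, Real.exp_log h1] at h
  refine h.trans_eq ?_
  field_simp
  ring

/-! ### The integrand of Ramanujan's integral representation -/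

/-- The integrand in the representation of `∑ k ≤ n, mlynarTail n k` as an integral. -/
noncomputable def ramanujanIntegrand (n : ℕ) (y : ℝ) : ℝ :=
  exp (-(√n * y)) * (1 + y / √n) ^ n

section Bounds

variable {n : ℕ} {y : ℝ}

lemma ramanujanIntegrand_eq_exp (hn : n ≠ 0) (hy : 0 ≤ y) :
    ramanujanIntegrand n y = exp (n * log (1 + y / √n) - √n * y) := by
  have h1 : 0 < 1 + y / √n := by positivity
  rw [ramanujanIntegrand, sub_eq_add_neg, Real.exp_add, Real.exp_nat_mul,
    Real.exp_log h1, mul_comm]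

lemma ramanujanIntegrand_le_exp (hn : n ≠ 0) (hy : 0 ≤ y) :
    ramanujanIntegrand n y ≤ exp (1 / 2) * exp (-(1 / 2 * y)) := by
  have hs : 1 ≤ √(n : ℝ) := by
    rw [Real.one_le_sqrt]; exact_mod_cast Nat.one_le_iff_ne_zero.2 hn
  have hs2 : √(n : ℝ) ^ 2 = n := Real.sq_sqrt (by positivity)
  rw [ramanujanIntegrand_eq_exp hn hy, ← Real.exp_add, Real.exp_le_exp]
  set s := √(n : ℝ)
  have h := mul_le_mul_of_nonneg_left (log_one_add_le_sub_div (u := y / s) (by positivity))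
    (sq_nonneg s)
  rw [← hs2]
  have e : s ^ 2 * (y / s - (y / s) ^ 2 / (2 * (1 + y / s))) = s * y - s * y ^ 2 / (2 * (s + y)) := by
    have : s + y ≠ 0 := by positivity
    have : s ≠ 0 := by positivity
    field_simp
  have h2 : 1 / 2 * y - 1 / 2 ≤ s * y ^ 2 / (2 * (s + y)) := by
    rw [le_div_iff₀ (by positivity)]
    nlinarith [mul_nonneg (sub_nonneg.2 hs) (sq_nonneg y)]
  linarith

/-- The logarithm of the ratio of `ramanujanIntegrand n` to its Gaussian limit. -/
noncomputable def logRatio (n : ℕ) (y : ℝ) : ℝ :=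
  n * log (1 + y / √n) - √n * y + y ^ 2 / 2

lemma ramanujanIntegrand_eq_mul (hn : n ≠ 0) (hy : 0 ≤ y) :
    ramanujanIntegrand n y = exp (-(1 / 2) * y ^ 2) * exp (logRatio n y) := by
  rw [ramanujanIntegrand_eq_exp hn hy, ← Real.exp_add, logRatio]
  ring_nf

lemma logRatio_nonneg (hn : n ≠ 0) (hy : 0 ≤ y) : 0 ≤ logRatio n y := by
  have hs : 0 < √(n : ℝ) := by positivity
  have hs2 : √(n : ℝ) ^ 2 = n := Real.sq_sqrt (by positivity)
  have h := mul_le_mul_of_nonneg_left (quadratic_le_log_one_add (u := y / √n) (by positivity))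
    (Nat.cast_nonneg (α := ℝ) n)
  have e : (n : ℝ) * (y / √n - (y / √n) ^ 2 / 2) = √n * y - y ^ 2 / 2 := by
    nth_rw 1 [← hs2]
    field_simp
  rw [logRatio]
  linarith

lemma sqrt_mul_logRatio_le (hn : n ≠ 0) (hy : 0 ≤ y) : √n * logRatio n y ≤ y ^ 3 / 3 := by
  have hs : 0 < √(n : ℝ) := by positivity
  have hs2 : √(n : ℝ) ^ 2 = n := Real.sq_sqrt (by positivity)
  have h := mul_le_mul_of_nonneg_left (log_one_add_le_cubic (u := y / √n) (by positivity))
    (Nat.cast_nonneg (α := ℝ) n)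
  have e : (n : ℝ) * (y / √n - (y / √n) ^ 2 / 2 + (y / √n) ^ 3 / 3) =
      √n * y - y ^ 2 / 2 + y ^ 3 / 3 / √n := by
    nth_rw 1 [← hs2]
    field_simp
  rw [← le_div_iff₀' hs, logRatio]
  linarith

lemma le_sqrt_mul_logRatio (hn : n ≠ 0) (hy : 0 ≤ y) :
    y ^ 3 / 3 - y ^ 4 / 4 / √n ≤ √n * logRatio n y := by
  have hs : 0 < √(n : ℝ) := by positivity
  have hs2 : √(n : ℝ) ^ 2 = n := Real.sq_sqrt (by positivity)
  have h := mul_le_mul_of_nonneg_left (quartic_le_log_one_add (u := y / √n) (by positivity))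
    (Nat.cast_nonneg (α := ℝ) n)
  have e : (n : ℝ) * (y / √n - (y / √n) ^ 2 / 2 + (y / √n) ^ 3 / 3 - (y / √n) ^ 4 / 4) =
      √n * y - y ^ 2 / 2 + (y ^ 3 / 3 - y ^ 4 / 4 / √n) / √n := by
    nth_rw 1 [← hs2]
    field_simp
    ring
  rw [← div_le_iff₀' hs, logRatio]
  linarith

/-- The scaled difference between `ramanujanIntegrand n` and its Gaussian limit. -/
noncomputable def scaledError (n : ℕ) (y : ℝ) : ℝ :=
  √n * (ramanujanIntegrand n y - exp (-(1 / 2) * y ^ 2))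

lemma scaledError_le (hn : n ≠ 0) (hy : 0 ≤ y) :
    scaledError n y ≤ y ^ 3 / 3 * ramanujanIntegrand n y := by
  refine le_trans ?_ (mul_le_mul_of_nonneg_right (sqrt_mul_logRatio_le hn hy) ?_)
  · rw [scaledError, mul_assoc]
    refine mul_le_mul_of_nonneg_left ?_ (Real.sqrt_nonneg _)
    have h : exp (-(1 / 2) * y ^ 2) = ramanujanIntegrand n y * exp (-logRatio n y) := by
      rw [ramanujanIntegrand_eq_mul hn hy, mul_assoc, ← Real.exp_add]; simp
    have hpos : 0 ≤ ramanujanIntegrand n y := by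
      rw [ramanujanIntegrand_eq_exp hn hy]; positivity
    rw [h]
    nlinarith [mul_le_mul_of_nonneg_left (Real.one_sub_le_exp_neg (logRatio n y)) hpos]
  · rw [ramanujanIntegrand_eq_exp hn hy]; positivity

lemma mul_logRatio_le_scaledError (hn : n ≠ 0) (hy : 0 ≤ y) :
    exp (-(1 / 2) * y ^ 2) * (√n * logRatio n y) ≤ scaledError n y := by
  rw [scaledError, ramanujanIntegrand_eq_mul hn hy, mul_left_comm]
  refine mul_le_mul_of_nonneg_left ?_ (Real.sqrt_nonneg _)
  nlinarith [mul_le_mul_of_nonneg_left (Real.add_one_le_exp (logRatio n y))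
    (Real.exp_pos (-(1 / 2) * y ^ 2)).le]

lemma norm_scaledError_le (hn : n ≠ 0) (hy : 0 ≤ y) :
    ‖scaledError n y‖ ≤ exp (1 / 2) / 3 * (y ^ 3 * exp (-(1 / 2 * y))) := by
  have h0 : 0 ≤ scaledError n y :=
    le_trans (by have := logRatio_nonneg hn hy; positivity) (mul_logRatio_le_scaledError hn hy)
  rw [Real.norm_of_nonneg h0]
  calc scaledError n y ≤ y ^ 3 / 3 * ramanujanIntegrand n y := scaledError_le hn hy
    _ ≤ y ^ 3 / 3 * (exp (1 / 2) * exp (-(1 / 2 * y))) := by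
      gcongr; exact ramanujanIntegrand_le_exp hn hy
    _ = _ := by ring

end Bounds

lemma tendsto_sqrt_natCast_atTop : Tendsto (fun n : ℕ => √(n : ℝ)) atTop atTop :=
  Real.tendsto_sqrt_atTop.comp tendsto_natCast_atTop_atTop

lemma tendsto_scaledError {y : ℝ} (hy : 0 ≤ y) :
    Tendsto (fun n => scaledError n y) atTop (𝓝 (1 / 3 * (y ^ 3 * exp (-(1 / 2) * y ^ 2)))) := by
  have hdiv : ∀ c : ℝ, Tendsto (fun n : ℕ => c / √(n : ℝ)) atTop (𝓝 0) := fun c =>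
    tendsto_sqrt_natCast_atTop.const_div_atTop c
  have hlow : Tendsto (fun n : ℕ => exp (-(1 / 2) * y ^ 2) * (y ^ 3 / 3 - y ^ 4 / 4 / √n)) atTop
      (𝓝 (1 / 3 * (y ^ 3 * exp (-(1 / 2) * y ^ 2)))) := by
    convert ((hdiv (y ^ 4 / 4)).const_sub (y ^ 3 / 3)).const_mul (exp (-(1 / 2) * y ^ 2)) using 2
    ring
  have hupp : Tendsto
      (fun n : ℕ => y ^ 3 / 3 * (exp (-(1 / 2) * y ^ 2) * exp (y ^ 3 / 3 / √n))) atTop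
      (𝓝 (1 / 3 * (y ^ 3 * exp (-(1 / 2) * y ^ 2)))) := by
    convert (((Real.continuous_exp.tendsto 0).comp (hdiv (y ^ 3 / 3))).const_mul
      (exp (-(1 / 2) * y ^ 2))).const_mul (y ^ 3 / 3) using 2
    · rfl
    · rw [Real.exp_zero]
      ring
  refine tendsto_of_tendsto_of_tendsto_of_le_of_le' hlow hupp ?_ ?_
  · filter_upwards [eventually_ne_atTop 0] with n hn
    exact (mul_le_mul_of_nonneg_left (le_sqrt_mul_logRatio hn hy) (Real.exp_pos _).le).trans
      (mul_logRatio_le_scaledError hn hy)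
  · filter_upwards [eventually_ne_atTop 0] with n hn
    refine (scaledError_le hn hy).trans ?_
    rw [ramanujanIntegrand_eq_mul hn hy]
    have hs : 0 < √(n : ℝ) := by positivity
    have h : logRatio n y ≤ y ^ 3 / 3 / √n := by
      rw [le_div_iff₀' hs]; exact sqrt_mul_logRatio_le hn hy
    gcongr

/-! ### Integrals -/

lemma integrableOn_pow_mul_exp_neg_mul (k : ℕ) {r : ℝ} (hr : 0 < r) :
    IntegrableOn (fun y : ℝ => y ^ k * exp (-(r * y))) (Set.Ioi 0) := by
  have h := integrableOn_rpow_mul_exp_neg_mul_rpow (p := 1) (s := k) (b := r)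
    (by have : (0 : ℝ) ≤ k := k.cast_nonneg
        linarith) one_pos hr
  simpa using h

lemma integral_pow_mul_exp_neg_mul (k : ℕ) {r : ℝ} (hr : 0 < r) :
    ∫ y in Set.Ioi (0 : ℝ), y ^ k * exp (-(r * y)) = k.factorial / r ^ (k + 1) := by
  have h := Real.integral_rpow_mul_exp_neg_mul_Ioi (a := k + 1) (r := r) (by positivity) hr
  rw [Real.Gamma_nat_eq_factorial] at h
  have e : (1 / r) ^ ((k : ℝ) + 1) = (1 / r) ^ (k + 1) := by
    rw [← Real.rpow_natCast]; push_cast; rfl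
  rw [e] at h
  simp only [add_sub_cancel_right, Real.rpow_natCast] at h
  rw [h, one_div, inv_pow, inv_mul_eq_div]

lemma integral_pow_three_mul_gaussian :
    ∫ y in Set.Ioi (0 : ℝ), y ^ 3 * exp (-(1 / 2) * y ^ 2) = 2 := by
  have h := integral_rpow_mul_exp_neg_mul_rpow (p := 2) (q := 3) (b := 1 / 2)
    (by norm_num) (by norm_num) (by norm_num)
  have e1 : (-((3 : ℝ) + 1) / 2) = ((-2 : ℤ) : ℝ) := by norm_num
  have e2 : (((3 : ℝ) + 1) / 2) = 2 := by norm_num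
  rw [e1, e2, Real.rpow_intCast, Real.Gamma_two] at h
  norm_num at h
  norm_num
  exact_mod_cast h

lemma ramanujanIntegrand_eq_sum (n : ℕ) (y : ℝ) :
    ramanujanIntegrand n y =
      ∑ k ∈ range (n + 1), (n.choose k : ℝ) / √n ^ k * (y ^ k * exp (-(√n * y))) := by
  rw [ramanujanIntegrand, add_comm 1, add_pow, Finset.mul_sum]
  refine Finset.sum_congr rfl fun k _ => ?_
  rw [div_pow]
  ring

lemma integrableOn_ramanujanIntegrand {n : ℕ} (hn : n ≠ 0) :
    IntegrableOn (ramanujanIntegrand n) (Set.Ioi 0) := by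
  rw [funext (ramanujanIntegrand_eq_sum n)]
  exact integrable_finsetSum _ fun k _ =>
    (integrableOn_pow_mul_exp_neg_mul k (by positivity)).const_mul _

lemma sqrt_mul_integral_ramanujanIntegrand {n : ℕ} (hn : n ≠ 0) :
    √n * ∫ y in Set.Ioi 0, ramanujanIntegrand n y = 1 + ∑ k ∈ Icc 1 n, mlynarTail n k := by
  have hs : 0 < √(n : ℝ) := by positivity
  have hs2 : √(n : ℝ) ^ 2 = n := Real.sq_sqrt (by positivity)
  simp_rw [ramanujanIntegrand_eq_sum]
  rw [integral_finsetSum _ fun k _ =>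
    (integrableOn_pow_mul_exp_neg_mul k hs).const_mul _, Finset.mul_sum]
  have h : ∀ k ∈ range (n + 1), √n * ∫ y in Set.Ioi (0 : ℝ),
      (n.choose k : ℝ) / √n ^ k * (y ^ k * exp (-(√n * y))) = mlynarTail n k := by
    intro k _
    rw [integral_const_mul, integral_pow_mul_exp_neg_mul k hs, mlynarTail,
      Nat.descFactorial_eq_factorial_mul_choose, ← hs2]
    push_cast
    rw [Real.sqrt_sq hs.le]
    field_simp
    ring
  rw [Finset.sum_congr rfl h, Finset.range_eq_Ico, Finset.sum_eq_sum_Ico_succ_bot (by omega)]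
  simp [mlynarTail, Finset.Ico_add_one_right_eq_Icc]

lemma integral_scaledError {n : ℕ} (hn : n ≠ 0) :
    ∫ y in Set.Ioi 0, scaledError n y =
      1 + ∑ k ∈ Icc 1 n, mlynarTail n k - √n * √(π / 2) := by
  have hg : √(π / (1 / 2)) / 2 = √(π / 2) := by
    rw [show π / (1 / 2) = π / 2 * 2 ^ 2 by ring, Real.sqrt_mul (by positivity),
      Real.sqrt_sq (by norm_num)]
    ring
  simp_rw [scaledError]
  rw [integral_const_mul, integral_sub (integrableOn_ramanujanIntegrand hn)
    (integrable_exp_neg_mul_sq (by norm_num)).integrableOn, mul_sub,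
    sqrt_mul_integral_ramanujanIntegrand hn, integral_gaussian_Ioi, hg]

/-- First two terms of the asymptotic expansion of Ramanujan's `Q`-function. -/
lemma tendsto_sum_mlynarTail_sub :
    Tendsto (fun n : ℕ => ∑ k ∈ Icc 1 n, mlynarTail n k - √n * √(π / 2)) atTop
      (𝓝 (-(1 / 3))) := by
  have h : Tendsto (fun n => ∫ y in Set.Ioi 0, scaledError n y) atTop
      (𝓝 (∫ y in Set.Ioi (0 : ℝ), 1 / 3 * (y ^ 3 * exp (-(1 / 2) * y ^ 2)))) := by
    refine tendsto_integral_filter_of_dominated_convergence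
      (fun y => exp (1 / 2) / 3 * (y ^ 3 * exp (-(1 / 2 * y)))) ?_ ?_ ?_ ?_
    · refine Eventually.of_forall fun n => Continuous.aestronglyMeasurable ?_
      unfold scaledError ramanujanIntegrand
      fun_prop
    · filter_upwards [eventually_ne_atTop 0] with n hn
      filter_upwards [ae_restrict_mem measurableSet_Ioi] with y hy
      exact norm_scaledError_le hn (le_of_lt hy)
    · exact (integrableOn_pow_mul_exp_neg_mul 3 (by norm_num)).const_mul _
    · filter_upwards [ae_restrict_mem measurableSet_Ioi] with y hy
      exact tendsto_scaledError (le_of_lt hy)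
  rw [integral_const_mul, integral_pow_three_mul_gaussian] at h
  have h' := h.sub_const 1
  rw [show (1 / 3 * 2 - 1 : ℝ) = -(1 / 3) by norm_num] at h'
  refine h'.congr' ?_
  filter_upwards [eventually_ne_atTop 0] with n hn
  rw [integral_scaledError hn]
  ring

theorem mlynar_scaled_variance_refined_asymptotic :
    Tendsto (fun n : ℕ => Real.sqrt n *
        ((1 / (n : ℝ)) *
            ((∑ k ∈ Finset.Icc 1 n, (k : ℝ) ^ 2 * mlynarP n k) -
              (∑ k ∈ Finset.Icc 1 n, (k : ℝ) * mlynarP n k) ^ 2) -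
          (2 - π / 2)))
      atTop (nhds (-Real.sqrt (π / 18))) := by
  have hc : √(π / 18) = √(π / 2) / 3 := by
    rw [show π / 18 = π / 2 / 3 ^ 2 by ring, Real.sqrt_div' _ (by norm_num),
      Real.sqrt_sq (by norm_num)]
  have hc2 : √(π / 2) ^ 2 = π / 2 := Real.sq_sqrt (by positivity)
  have hd := tendsto_sum_mlynarTail_sub
  set c := √(π / 2)
  have hlim := ((hd.const_mul (2 * c)).const_sub (-c)).sub
    ((hd.add (hd.pow 2)).div_atTop tendsto_sqrt_natCast_atTop)
  rw [show -c - 2 * c * -(1 / 3) - 0 = -√(π / 18) by rw [hc]; ring] at hlim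
  refine hlim.congr' ?_
  filter_upwards [eventually_ne_atTop 0] with n hn
  have hs : 0 < √(n : ℝ) := by positivity
  have hs2 : (n : ℝ) = √(n : ℝ) ^ 2 := (Real.sq_sqrt (by positivity)).symm
  rw [sum_id_mul_mlynarP hn, sum_sq_mul_mlynarP hn, ← hc2]
  set Q := ∑ k ∈ Icc 1 n, mlynarTail n k
  set s := √(n : ℝ)
  rw [hs2]
  field_simp
  ring
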